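/- Let κ ≥ 1 and r ≥ 2 be integers and let n_1 ≥ n_2 ≥ … ≥ n_r ≥ 2 be integers with n_k ≥ 3 for some 2 ≤ k ≤ r. Then ρ(K_κ ∨ (K_{n_1+1} ∪ … ∪ K_{n_k−1} ∪ … ∪ K_{n_r})) > ρ(K_κ ∨ (K_{n_1} ∪ K_{n_2} ∪ … ∪ K_{n_r})); that is, moving one vertex from the k-th complete part to the largest complete part strictly increases the spectral radius. -/

import Mathlib

open SimpleGraph

section Core

variable {V : Type*}

lemma adjMatrix_isHermitian [Fintype V] [DecidableEq V]
    (G : SimpleGraph V) [DecidableRel G.Adj] :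
    (G.adjMatrix ℝ).IsHermitian := by
  ext i j
  simp [Matrix.conjTranspose_apply, SimpleGraph.adj_comm]

/-- The spectral radius (largest adjacency eigenvalue) of a finite simple graph. -/
noncomputable def SimpleGraph.spectralRadius [Finite V] (G : SimpleGraph V) : ℝ :=
  letI := Fintype.ofFinite V
  letI := Classical.decEq V
  letI := Classical.decRel G.Adj
  ⨆ i, (adjMatrix_isHermitian G).eigenvalues i

/-- `x` is the Perron vector of a connected graph `G`: a positive unit eigenvector
of the adjacency matrix for the eigenvalue `G.spectralRadius`. -/
def SimpleGraph.IsPerronVector [Fintype V] [DecidableEq V] (G : SimpleGraph V)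
    [DecidableRel G.Adj] (x : V → ℝ) : Prop :=
  (∀ v, 0 < x v) ∧ (∑ v, x v ^ 2 = 1) ∧
    (G.adjMatrix ℝ).mulVec x = G.spectralRadius • x

/-- `S` is a vertex cut witnessing the `h`-extra `r`-component condition: removing `S`
leaves at least `r` connected components, each with at least `h+1` vertices. -/
def GoodVertexCut (G : SimpleGraph V) (r h : ℕ) (S : Finset V) : Prop :=
  r ≤ Nat.card (G.induce ((S : Set V)ᶜ)).ConnectedComponent ∧
    ∀ c : (G.induce ((S : Set V)ᶜ)).ConnectedComponent, h + 1 ≤ Nat.card c.supp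

/-- `G` has `h`-extra `r`-component connectivity `κ`. -/
def HasExtraConnectivity (G : SimpleGraph V) (r h κ : ℕ) : Prop :=
  (∃ S : Finset V, S.card = κ ∧ GoodVertexCut G r h S) ∧
    ∀ S : Finset V, GoodVertexCut G r h S → κ ≤ S.card

/-- `F` is an edge cut witnessing the `h`-extra `r`-component condition: removing `F`
leaves at least `r` connected components, each with at least `h+1` vertices. -/
def GoodEdgeCut (G : SimpleGraph V) (r h : ℕ) (F : Finset (Sym2 V)) : Prop :=
  (F : Set (Sym2 V)) ⊆ G.edgeSet ∧
    r ≤ Nat.card (G.deleteEdges (F : Set (Sym2 V))).ConnectedComponent ∧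
    ∀ c : (G.deleteEdges (F : Set (Sym2 V))).ConnectedComponent, h + 1 ≤ Nat.card c.supp

/-- `G` has `h`-extra `r`-component edge-connectivity `lam`. -/
def HasExtraEdgeConnectivity (G : SimpleGraph V) (r h lam : ℕ) : Prop :=
  (∃ F : Finset (Sym2 V), F.card = lam ∧ GoodEdgeCut G r h F) ∧
    ∀ F : Finset (Sym2 V), GoodEdgeCut G r h F → lam ≤ F.card

end Core

/-- The join `K_κ ∨ (K_{m 0} ∪ K_{m 1} ∪ ⋯ ∪ K_{m (r-1)})` of a complete graph on `κ`
vertices with a disjoint union of complete graphs of sizes `m 0, …, m (r-1)`. -/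
def completeMultiJoin (κ : ℕ) {r : ℕ} (m : Fin r → ℕ) :
    SimpleGraph (Fin κ ⊕ Σ i : Fin r, Fin (m i)) :=
  SimpleGraph.fromRel fun a b =>
    match a, b with
    | .inl _, _ => True
    | .inr p, .inr q => p.1 = q.1
    | _, _ => False

section SpectralRadius

variable {V : Type*} [Fintype V] [DecidableEq V] (G : SimpleGraph V) [DecidableRel G.Adj]

lemma spectralRadius_eq_iSup_eigenvalues :
    G.spectralRadius = ⨆ i, (adjMatrix_isHermitian G).eigenvalues i := by
  unfold SimpleGraph.spectralRadius
  congr!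

lemma dotProduct_mulVec_le_spectralRadius_mul (x : V → ℝ) :
    x ⬝ᵥ (G.adjMatrix ℝ).mulVec x ≤ G.spectralRadius * (x ⬝ᵥ x) := by
  set hA := adjMatrix_isHermitian G
  set b := hA.eigenvectorBasis
  have hA_symm (u v : V → ℝ) :
      u ⬝ᵥ (G.adjMatrix ℝ).mulVec v = (G.adjMatrix ℝ).mulVec u ⬝ᵥ v := by
    rw [Matrix.dotProduct_mulVec, ← Matrix.mulVec_transpose, SimpleGraph.transpose_adjMatrix]
  have hb (i : V) : (b i).ofLp ⬝ᵥ (G.adjMatrix ℝ).mulVec x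
      = hA.eigenvalues i * ((b i).ofLp ⬝ᵥ x) := by
    rw [hA_symm, hA.mulVec_eigenvectorBasis, smul_dotProduct, smul_eq_mul]
  have parseval (u v : V → ℝ) :
      ∑ i, ((b i).ofLp ⬝ᵥ u) * ((b i).ofLp ⬝ᵥ v) = u ⬝ᵥ v := by
    have h := b.sum_inner_mul_inner (WithLp.toLp 2 u) (WithLp.toLp 2 v)
    simp only [EuclideanSpace.inner_eq_star_dotProduct, star_trivial] at h
    rw [dotProduct_comm u v, ← h]
    exact Finset.sum_congr rfl fun i _ => by rw [dotProduct_comm v]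
  rw [← parseval x x, ← parseval x, Finset.mul_sum]
  refine Finset.sum_le_sum fun i _ => ?_
  have hi : hA.eigenvalues i ≤ G.spectralRadius := by
    rw [spectralRadius_eq_iSup_eigenvalues]
    exact le_ciSup (Set.finite_range _).bddAbove i
  rw [hb]
  nlinarith [mul_le_mul_of_nonneg_right hi (mul_self_nonneg ((b i).ofLp ⬝ᵥ x))]

lemma spectralRadius_le_of_pos_eigenvector [Nonempty V] {x : V → ℝ} {μ : ℝ}
    (hx : ∀ v, 0 < x v) (h : (G.adjMatrix ℝ).mulVec x = μ • x) : G.spectralRadius ≤ μ := by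
  rw [spectralRadius_eq_iSup_eigenvalues]
  refine ciSup_le fun i => ?_
  set hA := adjMatrix_isHermitian G
  set e : V → ℝ := (hA.eigenvectorBasis i).ofLp
  have he : (G.adjMatrix ℝ).mulVec e = hA.eigenvalues i • e := hA.mulVec_eigenvectorBasis i
  obtain ⟨v₀, hv₀⟩ : ∃ v, e v ≠ 0 := by
    by_contra! h0
    apply hA.eigenvectorBasis.toBasis.ne_zero i
    ext v
    simpa using h0 v
  have hpos : 0 < x ⬝ᵥ |e| :=
    Finset.sum_pos' (fun v _ => mul_nonneg (hx v).le (abs_nonneg _))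
      ⟨v₀, Finset.mem_univ _, mul_pos (hx v₀) (abs_pos.2 hv₀)⟩
  have hle (v : V) : hA.eigenvalues i * |e| v ≤ (G.adjMatrix ℝ).mulVec |e| v := by
    have hv := congrFun he v
    rw [SimpleGraph.adjMatrix_mulVec_apply] at hv ⊢
    calc hA.eigenvalues i * |e| v ≤ |hA.eigenvalues i * e v| := by
          rw [abs_mul]
          exact mul_le_mul_of_nonneg_right (le_abs_self _) (abs_nonneg _)
      _ = |∑ u ∈ G.neighborFinset v, e u| := by rw [hv]; rfl
      _ ≤ _ := Finset.abs_sum_le_sum_abs _ _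
  have key : hA.eigenvalues i * (x ⬝ᵥ |e|) ≤ μ * (x ⬝ᵥ |e|) := by
    calc hA.eigenvalues i * (x ⬝ᵥ |e|) = ∑ v, x v * (hA.eigenvalues i * |e| v) := by
          rw [dotProduct, Finset.mul_sum]
          exact Finset.sum_congr rfl fun v _ => by ring
      _ ≤ x ⬝ᵥ (G.adjMatrix ℝ).mulVec |e| :=
          Finset.sum_le_sum fun v _ => mul_le_mul_of_nonneg_left (hle v) (hx v).le
      _ = μ * (x ⬝ᵥ |e|) := by
          rw [Matrix.dotProduct_mulVec, ← Matrix.mulVec_transpose,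
            SimpleGraph.transpose_adjMatrix, h, smul_dotProduct, smul_eq_mul]
  exact le_of_mul_le_mul_right key hpos

end SpectralRadius

section CompleteMultiJoin

variable {κ r : ℕ} {m : Fin r → ℕ}

/-- The vector equal to `1` on the vertices of `K_κ` and to `z i` on the `i`-th part. -/
def partVector (κ : ℕ) (m : Fin r → ℕ) (z : Fin r → ℝ) : Fin κ ⊕ (Σ i : Fin r, Fin (m i)) → ℝ :=
  Sum.elim (fun _ => 1) fun p => z p.1

lemma completeMultiJoin_adj_inl (a : Fin κ) (w : Fin κ ⊕ Σ i : Fin r, Fin (m i)) :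
    (completeMultiJoin κ m).Adj (.inl a) w ↔ w ≠ .inl a := by
  rcases w with b | q <;> simp [completeMultiJoin, eq_comm]

lemma completeMultiJoin_adj_inr_inl (p : Σ i : Fin r, Fin (m i)) (a : Fin κ) :
    (completeMultiJoin κ m).Adj (.inr p) (.inl a) := by
  simp [completeMultiJoin]

lemma completeMultiJoin_adj_inr_inr (p q : Σ i : Fin r, Fin (m i)) :
    (completeMultiJoin κ m).Adj (.inr p) (.inr q) ↔ q ≠ p ∧ q.1 = p.1 := by
  simp only [completeMultiJoin, SimpleGraph.fromRel_adj, ne_eq, Sum.inr.injEq]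
  tauto

lemma adjMatrix_mulVec_partVector_inl [DecidableRel (completeMultiJoin κ m).Adj]
    (z : Fin r → ℝ) (a : Fin κ) :
    ((completeMultiJoin κ m).adjMatrix ℝ).mulVec (partVector κ m z) (.inl a)
      = κ - 1 + ∑ i, m i * z i := by
  classical
  have hN : (completeMultiJoin κ m).neighborFinset (.inl a) = Finset.univ.erase (.inl a) := by
    ext w
    simp [completeMultiJoin_adj_inl]
  rw [SimpleGraph.adjMatrix_mulVec_apply, hN, Finset.sum_erase_eq_sub (Finset.mem_univ _),
    Fintype.sum_sum_type, Fintype.sum_sigma]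
  simp [partVector]
  ring

lemma adjMatrix_mulVec_partVector_inr [DecidableRel (completeMultiJoin κ m).Adj]
    (z : Fin r → ℝ) (p : Σ i : Fin r, Fin (m i)) :
    ((completeMultiJoin κ m).adjMatrix ℝ).mulVec (partVector κ m z) (.inr p)
      = κ + (m p.1 - 1) * z p.1 := by
  classical
  have hsplit (q : Σ i : Fin r, Fin (m i)) :
      (if q ≠ p ∧ q.1 = p.1 then z q.1 else 0)
        = (if q.1 = p.1 then z q.1 else 0) - (if q = p then z p.1 else 0) := by
    by_cases hq : q = p
    · simp [hq]
    · simp [hq]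
  rw [SimpleGraph.adjMatrix_mulVec_apply, SimpleGraph.neighborFinset_eq_filter,
    Finset.sum_filter, Fintype.sum_sum_type]
  simp only [completeMultiJoin_adj_inr_inl, completeMultiJoin_adj_inr_inr, partVector,
    Sum.elim_inl, Sum.elim_inr, if_true, hsplit, Finset.sum_sub_distrib, Finset.sum_ite_eq',
    Finset.mem_univ, Fintype.sum_sigma]
  simp
  ring

/-- If `t` solves the characteristic equation of the quotient matrix, then `t - 1` bounds the
spectral radius. -/
lemma spectralRadius_completeMultiJoin_le (hκ : 1 ≤ κ) {t : ℝ} (ht : ∀ i, (m i : ℝ) < t)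
    (h : ∑ i, m i * (κ / (t - m i)) = t - κ) :
    (completeMultiJoin κ m).spectralRadius ≤ t - 1 := by
  classical
  have hκ' : (0 : ℝ) < κ := by exact_mod_cast hκ
  have : Nonempty (Fin κ ⊕ Σ i : Fin r, Fin (m i)) := ⟨.inl ⟨0, hκ⟩⟩
  refine spectralRadius_le_of_pos_eigenvector _
    (x := partVector κ m fun i => κ / (t - m i)) ?_ ?_
  · rintro (a | p)
    · exact one_pos
    · exact div_pos hκ' (sub_pos.2 (ht _))
  · ext (a | p)
    · rw [adjMatrix_mulVec_partVector_inl, h]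
      simp [partVector]
    · rw [adjMatrix_mulVec_partVector_inr]
      have := (sub_pos.2 (ht p.1)).ne'
      simp only [partVector, Pi.smul_apply, Sum.elim_inr, smul_eq_mul]
      field_simp
      ring

lemma lt_spectralRadius_completeMultiJoin (hκ : 1 ≤ κ) {s : ℝ} (hs : ∀ i, (m i : ℝ) < s)
    (h : s - κ < ∑ i, m i * (κ / (s - m i))) :
    s - 1 < (completeMultiJoin κ m).spectralRadius := by
  classical
  set z : Fin r → ℝ := fun i => κ / (s - m i)
  set y := partVector κ m z
  have hκ' : (0 : ℝ) < κ := by exact_mod_cast hκ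
  have hz (i : Fin r) : 0 < z i := div_pos hκ' (sub_pos.2 (hs i))
  have hinl (a : Fin κ) : (s - 1) * y (.inl a)
      < ((completeMultiJoin κ m).adjMatrix ℝ).mulVec y (.inl a) := by
    rw [adjMatrix_mulVec_partVector_inl]
    simp only [y, partVector, Sum.elim_inl]
    linarith
  have hinr (p : Σ i : Fin r, Fin (m i)) : (s - 1) * y (.inr p)
      = ((completeMultiJoin κ m).adjMatrix ℝ).mulVec y (.inr p) := by
    rw [adjMatrix_mulVec_partVector_inr]
    have := (sub_pos.2 (hs p.1)).ne'
    simp only [y, z, partVector, Sum.elim_inr]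
    field_simp
    ring
  have hy (v) : 0 < y v := by
    rcases v with a | p
    · exact one_pos
    · exact hz _
  have hyy : 0 < y ⬝ᵥ y :=
    Finset.sum_pos (fun v _ => mul_pos (hy v) (hy v)) ⟨.inl ⟨0, hκ⟩, Finset.mem_univ _⟩
  have hlt : (s - 1) * (y ⬝ᵥ y) < y ⬝ᵥ ((completeMultiJoin κ m).adjMatrix ℝ).mulVec y := by
    rw [dotProduct, Finset.mul_sum]
    refine Finset.sum_lt_sum (fun v _ => ?_) ⟨.inl ⟨0, hκ⟩, Finset.mem_univ _, ?_⟩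
    · rw [mul_left_comm]
      refine mul_le_mul_of_nonneg_left ?_ (hy v).le
      rcases v with a | p
      · exact (hinl a).le
      · exact (hinr p).le
    · rw [mul_left_comm]
      exact mul_lt_mul_of_pos_left (hinl _) (hy _)
  exact lt_of_mul_lt_mul_right
    (hlt.trans_le (dotProduct_mulVec_le_spectralRadius_mul _ y)) hyy.le

/-- At a point half a unit above the largest part, the pole of that part dominates. -/
lemma sub_lt_sum_of_eq_add_half (hκ : 1 ≤ κ) {i₀ : Fin r} (hi₀ : 1 ≤ m i₀)
    (hmax : ∀ i, m i ≤ m i₀) {s : ℝ} (hs : s = m i₀ + 1 / 2) :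
    s - κ < ∑ i, m i * (κ / (s - m i)) := by
  have hκ' : (1 : ℝ) ≤ κ := by exact_mod_cast hκ
  have hm' : (1 : ℝ) ≤ m i₀ := by exact_mod_cast hi₀
  have hterm : (m i₀ : ℝ) * (κ / (s - m i₀)) ≤ ∑ i, m i * (κ / (s - m i)) := by
    refine Finset.single_le_sum (f := fun i => (m i : ℝ) * (κ / (s - m i)))
      (fun i _ => ?_) (Finset.mem_univ i₀)
    have : (m i : ℝ) ≤ m i₀ := by exact_mod_cast hmax i
    exact mul_nonneg (Nat.cast_nonneg _) (div_nonneg (Nat.cast_nonneg _) (by linarith))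
  refine lt_of_lt_of_le ?_ hterm
  rw [hs, add_sub_cancel_left, div_div_eq_mul_div]
  nlinarith

lemma exists_sum_eq_sub (hκ : 1 ≤ κ) {i₀ : Fin r} (hi₀ : 1 ≤ m i₀) (hmax : ∀ i, m i ≤ m i₀) :
    ∃ t : ℝ, (m i₀ : ℝ) < t ∧ ∑ i, m i * (κ / (t - m i)) = t - κ := by
  have hmax' (i : Fin r) : (m i : ℝ) ≤ m i₀ := by exact_mod_cast hmax i
  have hS : (0 : ℝ) ≤ ∑ i, (m i : ℝ) * κ :=
    Finset.sum_nonneg fun i _ => by positivity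
  set a : ℝ := m i₀ + 1 / 2 with ha
  set b : ℝ := κ + m i₀ + 1 + ∑ i, (m i : ℝ) * κ with hb
  have hκ' : (1 : ℝ) ≤ κ := by exact_mod_cast hκ
  have hab : a ≤ b := by linarith
  have hcont : ContinuousOn (fun t : ℝ => t - κ - ∑ i, m i * (κ / (t - m i))) (Set.Icc a b) := by
    refine (by fun_prop : ContinuousOn (fun t : ℝ => t - κ) _).sub
      (continuousOn_finsetSum _ fun i _ => ?_)
    refine continuousOn_const.mul (continuousOn_const.div (by fun_prop) fun t ht => ?_)
    have := ht.1
    have := hmax' i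
    exact (by linarith : (0 : ℝ) < t - m i).ne'
  have hbsum : ∑ i, m i * (κ / (b - m i)) ≤ ∑ i, (m i : ℝ) * κ := by
    refine Finset.sum_le_sum fun i _ => ?_
    have := hmax' i
    exact mul_le_mul_of_nonneg_left (div_le_self (by linarith) (by linarith)) (Nat.cast_nonneg _)
  have hlow := sub_lt_sum_of_eq_add_half hκ hi₀ hmax ha
  obtain ⟨t, ht, h0⟩ := intermediate_value_Icc hab hcont
    (show (0 : ℝ) ∈ Set.Icc _ _ from ⟨by linarith, by linarith [Nat.cast_nonneg (α := ℝ) (m i₀)]⟩)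
  exact ⟨t, by linarith [ht.1], by linarith [h0]⟩

end CompleteMultiJoin

lemma mul_div_sub_add_lt_of_move {c p q t : ℝ} (hc : 0 < c) (hqp : q ≤ p) (hq : 0 < q)
    (ht : p + 1 < t) :
    p * (c / (t - p)) + q * (c / (t - q))
      < (p + 1) * (c / (t - (p + 1))) + (q - 1) * (c / (t - (q - 1))) := by
  have h1 : 0 < t - (p + 1) := by linarith
  have h2 : 0 < t - p := by linarith
  have h3 : 0 < t - q := by linarith
  have h4 : 0 < t - (q - 1) := by linarith
  have key (u : ℝ) (hu : 0 < t - u) : u * (c / (t - u)) = c * t * (1 / (t - u)) - c := by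
    field_simp
    ring
  rw [key _ h1, key _ h2, key _ h3, key _ h4]
  have hsum : 1 / (t - p) + 1 / (t - q) < 1 / (t - (p + 1)) + 1 / (t - (q - 1)) := by
    rw [div_add_div _ _ h2.ne' h3.ne', div_add_div _ _ h1.ne' h4.ne', div_lt_div_iff₀
      (by positivity) (by positivity)]
    have hprod : (t - (p + 1)) * (t - (q - 1)) < (t - p) * (t - q) := by nlinarith
    nlinarith [mul_lt_mul_of_pos_left hprod (add_pos h2 h3)]
  nlinarith [mul_lt_mul_of_pos_left hsum (mul_pos hc (by linarith : 0 < t))]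

lemma sum_lt_sum_update_update {ι : Type*} [Fintype ι] [DecidableEq ι] {i₀ k : ι} (hk : k ≠ i₀)
    {m : ι → ℕ} (f : ℕ → ℝ) {p q : ℕ} (h : f (m i₀) + f (m k) < f p + f q) :
    ∑ i, f (m i) < ∑ i, f (Function.update (Function.update m k q) i₀ p i) := by
  have hsplit (g : ι → ℝ) : ∑ i, g i = g i₀ + (g k + ∑ i ∈ (Finset.univ.erase i₀).erase k, g i) := by
    rw [Finset.add_sum_erase _ _ (by simp [hk]), Finset.add_sum_erase _ _ (Finset.mem_univ _)]
  rw [hsplit, hsplit fun i => f (Function.update (Function.update m k q) i₀ p i)]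
  have hrest : ∑ i ∈ (Finset.univ.erase i₀).erase k,
      f (Function.update (Function.update m k q) i₀ p i)
      = ∑ i ∈ (Finset.univ.erase i₀).erase k, f (m i) := by
    refine Finset.sum_congr rfl fun i hi => ?_
    simp only [Finset.mem_erase] at hi
    rw [Function.update_of_ne hi.2.1, Function.update_of_ne hi.1]
  rw [hrest, Function.update_self, Function.update_of_ne hk, Function.update_self]
  linarith

/-- Moving a vertex from a part with at least two vertices to a largest part strictly increases the
spectral radius. -/
lemma spectralRadius_lt_update_update {κ r : ℕ} (hκ : 1 ≤ κ) {m : Fin r → ℕ} {i₀ k : Fin r}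
    (hki : k ≠ i₀) (hmax : ∀ i, m i ≤ m i₀) (hk : 1 ≤ m k) :
    (completeMultiJoin κ m).spectralRadius <
      (completeMultiJoin κ
        (Function.update (Function.update m k (m k - 1)) i₀ (m i₀ + 1))).spectralRadius := by
  set m' := Function.update (Function.update m k (m k - 1)) i₀ (m i₀ + 1) with hm'
  have hm'₀ : m' i₀ = m i₀ + 1 := Function.update_self ..
  have hmax' (i : Fin r) : m' i ≤ m' i₀ := by
    rw [hm'₀, hm']
    have := hmax i
    have := hmax k
    simp only [Function.update_apply]
    split_ifs <;> omega
  obtain ⟨t, ht, hsum⟩ := exists_sum_eq_sub hκ (hk.trans (hmax k)) hmax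
  have hle := spectralRadius_completeMultiJoin_le hκ
    (fun i => (Nat.cast_le.2 (hmax i)).trans_lt ht) hsum
  rcases le_or_gt t (m i₀ + 1) with htle | htgt
  · refine hle.trans_lt (lt_of_le_of_lt ?_ (lt_spectralRadius_completeMultiJoin hκ
      (s := m' i₀ + 1 / 2) (fun i => ?_) (sub_lt_sum_of_eq_add_half hκ (by omega) hmax' rfl)))
    · rw [hm'₀]
      push_cast
      linarith
    · have : (m' i : ℝ) ≤ m' i₀ := by exact_mod_cast hmax' i
      linarith
  · refine hle.trans_lt (lt_spectralRadius_completeMultiJoin hκ (fun i => ?_) ?_)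
    · have : (m' i : ℝ) ≤ m' i₀ := by exact_mod_cast hmax' i
      rw [hm'₀] at this
      push_cast at this
      linarith
    · rw [← hsum]
      refine sum_lt_sum_update_update hki (fun n : ℕ => (n : ℝ) * (κ / (t - n))) ?_
      have hcast : ((m k - 1 : ℕ) : ℝ) = m k - 1 := by
        rw [Nat.cast_sub (by omega), Nat.cast_one]
      simp only [hcast, Nat.cast_add, Nat.cast_one]
      exact mul_div_sub_add_lt_of_move (by exact_mod_cast hκ) (by exact_mod_cast hmax k)
        (by exact_mod_cast (by omega : 0 < m k)) htgt

theorem spectralRadius_lt_of_move_vertex_to_largest_part (κ r : ℕ)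
    (hκ : 1 ≤ κ) (hr : 2 ≤ r) (m : Fin r → ℕ)
    (hmono : ∀ i j : Fin r, i ≤ j → m j ≤ m i) (h2 : ∀ i, 2 ≤ m i)
    (k : Fin r) (hk : 1 ≤ (k : ℕ)) (hk3 : 3 ≤ m k) :
    (completeMultiJoin κ m).spectralRadius <
      (completeMultiJoin κ
        (Function.update (Function.update m k (m k - 1)) ⟨0, by omega⟩
          (m ⟨0, by omega⟩ + 1))).spectralRadius := by
  refine spectralRadius_lt_update_update hκ ?_ (fun i => hmono _ i (Nat.zero_le _)) (by omega)
  exact Fin.ne_of_val_ne (Nat.ne_of_gt hk)
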